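/- arXiv:1904.05913 — 5 statements merged into one kernel-verified Lean document; each statement's English description precedes it below -/
import Mathlib

section
/- Let ε>0, ℓ>0, f ∈ C²(ℝ) and u_- > u_+. Set m = min_{u∈[u_+,u_-]} f(u), M = max_{u∈[u_+,u_-]} f(u), and B = ∫_{u_+}^{u_-} [1 + 2√((f(s)−m)(1−(f(s)−m)))] / [1 − 2(f(s)−m)] ds. Then there exists a unique strictly decreasing C¹ function v on [−ℓ,ℓ] with v(−ℓ)=u_-, v(ℓ)=u_+, satisfying −ε^{-1} < v'(x) < 0 for all x, for which there is a constant c∈ℝ such that ε v'(x)/(1+ε² v'(x)²) = f(v(x)) + c for all x∈[−ℓ,ℓ] (i.e., v is a smooth decreasing solution of (ε v_x/(1+ε² v_x²))_x = (f(v))_x with v(±ℓ)=u_±), if and only if M−m < 1/2 and 2ℓ/ε > B. -/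
open Set Filter Topology MeasureTheory

/-- `v` (with derivative `v'`) is a strictly decreasing C¹ solution, with slope in
`(-ε⁻¹, 0)`, of the stationary problem `(ε v_x/(1+ε²v_x²))_x = (f(v))_x`, `v(±ℓ)=u_±`,
i.e. there is a constant `c` with `ε v'/(1+ε²v'²) = f(v) + c` on `[-ℓ,ℓ]`. -/
def IsDecSteadyNM (l ε : ℝ) (f : ℝ → ℝ) (um up : ℝ) (v v' : ℝ → ℝ) (c : ℝ) : Prop :=
  StrictAntiOn v (Set.Icc (-l) l) ∧
  ContinuousOn v' (Set.Icc (-l) l) ∧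
  (∀ x ∈ Set.Icc (-l) l, HasDerivAt v (v' x) x) ∧
  v (-l) = um ∧ v l = up ∧
  (∀ x ∈ Set.Icc (-l) l, -ε⁻¹ < v' x ∧ v' x < 0) ∧
  ∀ x ∈ Set.Icc (-l) l, ε * v' x / (1 + ε ^ 2 * v' x ^ 2) = f (v x) + c

/-- The reciprocal of the smaller root `s` of `s / (1 + s²) = y`, for `y ∈ (0, 1/2]`. -/
noncomputable def recipSlope (y : ℝ) : ℝ := (1 + Real.sqrt (1 - 4 * y ^ 2)) / (2 * y)

lemma recipSlope_strictAntiOn : StrictAntiOn recipSlope (Ioi 0) := by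
  intro a ha b hb hab
  have ha' : (0 : ℝ) < a := ha
  have hb' : (0 : ℝ) < b := hb
  have h1 : Real.sqrt (1 - 4 * b ^ 2) ≤ Real.sqrt (1 - 4 * a ^ 2) :=
    Real.sqrt_le_sqrt (by nlinarith)
  have h2 := Real.sqrt_nonneg (1 - 4 * b ^ 2)
  unfold recipSlope
  rw [div_lt_div_iff₀ (by positivity) (by positivity)]
  nlinarith

lemma continuous_recipSlope_comp {X : Type*} [TopologicalSpace X] {g : X → ℝ}
    (hg : Continuous g) (hpos : ∀ x, 0 < g x) : Continuous fun x => recipSlope (g x) := by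
  unfold recipSlope
  refine Continuous.div (by fun_prop) (by fun_prop) fun x => ?_
  have := hpos x
  positivity

lemma inv_le_recipSlope {y : ℝ} (hy : 0 < y) : 1 / (2 * y) ≤ recipSlope y := by
  unfold recipSlope
  gcongr
  linarith [Real.sqrt_nonneg (1 - 4 * y ^ 2)]

lemma one_lt_recipSlope {y : ℝ} (hy : 0 < y) (hy' : y < 1 / 2) : 1 < recipSlope y :=
  lt_of_lt_of_le (by rw [lt_div_iff₀ (by positivity)]; linarith) (inv_le_recipSlope hy)

lemma recipSlope_flux {s : ℝ} (hs : s ∈ Ioo (-1) 0) :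
    recipSlope (-(s / (1 + s ^ 2))) = -1 / s := by
  obtain ⟨h1, h2⟩ := hs
  have h3 : (0 : ℝ) < 1 + s ^ 2 := by positivity
  have h4 : 1 - 4 * (-(s / (1 + s ^ 2))) ^ 2 = ((1 - s ^ 2) / (1 + s ^ 2)) ^ 2 := by
    field_simp
    ring
  have h5 : 0 ≤ (1 - s ^ 2) / (1 + s ^ 2) := div_nonneg (by nlinarith) h3.le
  have h6 : s ≠ 0 := h2.ne
  rw [recipSlope, h4, Real.sqrt_sq h5]
  field_simp
  ring

lemma flux_inv_recipSlope {y : ℝ} (hy : 0 < y) (hy' : y < 1 / 2) :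
    -(1 / recipSlope y) / (1 + (-(1 / recipSlope y)) ^ 2) = -y := by
  have h2 := Real.sqrt_nonneg (1 - 4 * y ^ 2)
  have h3 := Real.sq_sqrt (show 0 ≤ 1 - 4 * y ^ 2 by nlinarith)
  unfold recipSlope
  set r := Real.sqrt (1 - 4 * y ^ 2)
  have h4 : 1 + r ≠ 0 := by positivity
  have h5 : 0 < (1 + r) ^ 2 + (2 * y) ^ 2 := by positivity
  have h6 : -(1 / ((1 + r) / (2 * y))) = -(2 * y) / (1 + r) := by field_simp
  have h7 : 1 + (-(2 * y) / (1 + r)) ^ 2 = 2 / (1 + r) := by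
    field_simp
    nlinarith
  rw [h6, h7]
  field_simp

lemma exists_inverse_of_one_le_deriv {G h : ℝ → ℝ} (hh : ∀ x, 1 ≤ h x)
    (hG : ∀ x, HasDerivAt G (h x) x) :
    ∃ g : ℝ → ℝ, (∀ x, g (G x) = x) ∧ ∀ t, HasDerivAt g (h (g t))⁻¹ t := by
  have hmono : Monotone fun x => G x - x := by
    refine monotone_of_deriv_nonneg (fun x => ((hG x).sub (hasDerivAt_id x)).differentiableAt)
      fun x => ?_
    have h1 : HasDerivAt (fun x => G x - x) (h x - 1) x := (hG x).sub (hasDerivAt_id x)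
    rw [h1.deriv]
    linarith [hh x]
  have hstrict : StrictMono G := fun a b hab => by
    have : G a - a ≤ G b - b := hmono hab.le
    linarith
  have hcont : Continuous G := continuous_iff_continuousAt.2 fun x => (hG x).continuousAt
  have hsurj : Function.Surjective G := by
    refine hcont.surjective ?_ ?_
    · refine tendsto_atTop_mono' _ ?_ (tendsto_atTop_add_const_right _ (G 0 - 0) tendsto_id)
      filter_upwards [eventually_ge_atTop 0] with x hx
      have : G 0 - 0 ≤ G x - x := hmono hx
      simp only [id]
      linarith
    · refine tendsto_atBot_mono' _ ?_ (tendsto_atBot_add_const_right _ (G 0 - 0) tendsto_id)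
      filter_upwards [eventually_le_atBot 0] with x hx
      have : G x - x ≤ G 0 - 0 := hmono hx
      simp only [id]
      linarith
  let e := hstrict.orderIsoOfSurjective G hsurj
  refine ⟨e.symm, fun x => e.symm_apply_apply x, fun t => ?_⟩
  refine HasDerivAt.of_local_left_inverse (f := G) e.symm.continuous.continuousAt (hG _) ?_ ?_
  · linarith [hh (e.symm t)]
  · exact Eventually.of_forall fun y => e.apply_symm_apply y

lemma log_le_integral_inv_dist {a b s₀ K d : ℝ} (hs : s₀ ∈ Icc a b) (hK : 0 < K) (hd : 0 < d) :
    Real.log (1 + K * (b - a) / d) / (2 * K) ≤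
      ∫ s in a..b, 1 / (2 * (K * |s - s₀| + d)) := by
  obtain ⟨h1, h2⟩ := hs
  have hpos : ∀ s, 0 < K * |s - s₀| + d := fun s => by positivity
  have hcont : Continuous fun s => 1 / (2 * (K * |s - s₀| + d)) :=
    Continuous.div (by fun_prop) (by fun_prop) fun s => by have := hpos s; positivity
  have hR : ∫ s in s₀..b, 1 / (2 * (K * |s - s₀| + d)) =
      Real.log (K * (b - s₀) + d) / (2 * K) - Real.log d / (2 * K) := by
    rw [intervalIntegral.integral_eq_sub_of_hasDerivAt
      (f := fun s => Real.log (K * (s - s₀) + d) / (2 * K)) _ (hcont.intervalIntegrable _ _)]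
    · simp
    · intro s hs
      rw [uIcc_of_le h2] at hs
      have h3 : 0 ≤ s - s₀ := sub_nonneg.2 hs.1
      have h4 : 0 < K * (s - s₀) + d := by positivity
      have h5 : HasDerivAt (fun s => K * (s - s₀) + d) (K * 1) s :=
        (((hasDerivAt_id s).sub_const s₀).const_mul K).add_const d
      refine ((h5.log h4.ne').div_const (2 * K)).congr_deriv ?_
      rw [abs_of_nonneg h3]
      field_simp
  have hL : ∫ s in a..s₀, 1 / (2 * (K * |s - s₀| + d)) =
      Real.log (K * (s₀ - a) + d) / (2 * K) - Real.log d / (2 * K) := by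
    rw [intervalIntegral.integral_eq_sub_of_hasDerivAt
      (f := fun s => -(Real.log (K * (s₀ - s) + d) / (2 * K))) _ (hcont.intervalIntegrable _ _)]
    · simp
      ring
    · intro s hs
      rw [uIcc_of_le h1] at hs
      have h3 : s - s₀ ≤ 0 := sub_nonpos.2 hs.2
      have h3' : 0 ≤ s₀ - s := by linarith
      have h4 : 0 < K * (s₀ - s) + d := by positivity
      have h5 : HasDerivAt (fun s => K * (s₀ - s) + d) (K * (-1)) s :=
        (((hasDerivAt_id s).const_sub s₀).const_mul K).add_const d
      refine ((h5.log h4.ne').div_const (2 * K)).neg.congr_deriv ?_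
      rw [abs_of_nonpos h3, neg_sub]
      field_simp
  rw [← intervalIntegral.integral_add_adjacent_intervals (b := s₀)
    (hcont.intervalIntegrable _ _) (hcont.intervalIntegrable _ _), hL, hR]
  have ha : 0 ≤ s₀ - a := by linarith
  have hb : 0 ≤ b - s₀ := by linarith
  have hba : 0 ≤ b - a := by linarith
  have key : Real.log (1 + K * (b - a) / d) + Real.log d + Real.log d ≤
      Real.log (K * (s₀ - a) + d) + Real.log (K * (b - s₀) + d) := by
    rw [← Real.log_mul (by positivity) (by positivity),
      ← Real.log_mul (by positivity) (by positivity),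
      ← Real.log_mul (by positivity) (by positivity)]
    refine Real.log_le_log (by positivity) ?_
    have h6 : (1 + K * (b - a) / d) * d * d = (d + K * (b - a)) * d := by field_simp
    rw [h6]
    nlinarith [mul_nonneg (mul_nonneg hK.le ha) (mul_nonneg hK.le hb)]
  rw [← sub_div, ← sub_div, ← add_div]
  gcongr
  linarith

/-- The function `f` on `[a, b]`, extended to the line by its values at the end points. -/
def clampExtend (a b : ℝ) (f : ℝ → ℝ) (s : ℝ) : ℝ := f (max a (min s b))

lemma clampExtend_of_mem {a b s : ℝ} (f : ℝ → ℝ) (hs : s ∈ Icc a b) :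
    clampExtend a b f s = f s := by
  rw [clampExtend, min_eq_left hs.2, max_eq_right hs.1]

lemma clampExtend_mem_image {a b : ℝ} (f : ℝ → ℝ) (hab : a ≤ b) (s : ℝ) :
    clampExtend a b f s ∈ f '' Icc a b :=
  ⟨_, ⟨le_max_left _ _, max_le hab (min_le_right _ _)⟩, rfl⟩

lemma continuous_clampExtend {a b : ℝ} {f : ℝ → ℝ} (hf : Continuous f) :
    Continuous (clampExtend a b f) := by
  unfold clampExtend
  fun_prop

/-- The rescaled length of the interval on which the solution of the stationary equation with
integration constant `-(k + d)` runs through `[a, b]`. -/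
noncomputable def transitTime (F : ℝ → ℝ) (a b k d : ℝ) : ℝ :=
  ∫ s in a..b, recipSlope (k - F s + d)

lemma transitTime_strictAntiOn {F : ℝ → ℝ} {a b k : ℝ} (hF : Continuous F) (hk : ∀ s, F s ≤ k)
    (hab : a < b) : StrictAntiOn (transitTime F a b k) (Ioi 0) := by
  intro d hd e he hde
  have hd' : 0 < d := hd
  have he' : 0 < e := he
  have h1 : ∀ s, 0 < k - F s + d := fun s => by linarith [hk s]
  have h2 : ∀ s, 0 < k - F s + e := fun s => by linarith [hk s]
  have hlt : ∀ s, recipSlope (k - F s + e) < recipSlope (k - F s + d) := fun s =>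
    recipSlope_strictAntiOn (h1 s) (h2 s) (by linarith)
  exact intervalIntegral.integral_lt_integral_of_continuousOn_of_le_of_exists_lt hab
    (continuous_recipSlope_comp (by fun_prop) h2).continuousOn
    (continuous_recipSlope_comp (by fun_prop) h1).continuousOn
    (fun s _ => (hlt s).le) ⟨a, left_mem_Icc.2 hab.le, hlt a⟩

lemma transitTime_continuousOn {F : ℝ → ℝ} {a b k δ : ℝ} (hF : Continuous F)
    (hk : ∀ s, F s ≤ k) (hδ : 0 < δ) : ContinuousOn (transitTime F a b k) (Ici δ) := by
  have h : Continuous fun d => transitTime F a b k (max δ d) := by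
    refine intervalIntegral.continuous_parametric_intervalIntegral_of_continuous' ?_ a b
    refine continuous_recipSlope_comp (g := fun p : ℝ × ℝ => k - F p.2 + max δ p.1)
      (by fun_prop) fun p => ?_
    linarith [hk p.2, le_max_left δ p.1]
  exact h.continuousOn.congr fun d hd => by simp only [max_eq_right (mem_Ici.1 hd)]

lemma exists_lt_transitTime {f : ℝ → ℝ} {a b k : ℝ} (hf : ContDiff ℝ 1 f) (hab : a < b)
    (hk : IsGreatest (f '' Icc a b) k) (A : ℝ) {d₀ : ℝ} (hd₀ : 0 < d₀) :
    ∃ d, 0 < d ∧ d ≤ d₀ ∧ A < transitTime (clampExtend a b f) a b k d := by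
  obtain ⟨⟨s₀, hs₀, rfl⟩, hmax⟩ := hk
  obtain ⟨C, hC⟩ := isCompact_Icc.exists_bound_of_continuousOn (s := Icc a b)
    (hf.continuous_deriv le_rfl).continuousOn
  set K := |C| + 1
  have hK : 0 < K := by positivity
  have hlip : ∀ s ∈ Icc a b, f s₀ - f s ≤ K * |s - s₀| := by
    intro s hs
    have h := (convex_Icc a b).norm_image_sub_le_of_norm_deriv_le
      (fun x _ => (hf.differentiable (by norm_num)).differentiableAt)
      (fun x hx => (hC x hx).trans (show C ≤ K by linarith [le_abs_self C])) hs hs₀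
    rw [Real.norm_eq_abs, Real.norm_eq_abs, abs_sub_comm s₀ s] at h
    exact (le_abs_self _).trans h
  have hL : 0 < K * (b - a) := mul_pos hK (sub_pos.2 hab)
  refine ⟨min d₀ (K * (b - a) / Real.exp (2 * K * A)), by positivity, min_le_left _ _, ?_⟩
  set d := min d₀ (K * (b - a) / Real.exp (2 * K * A))
  have hd : 0 < d := by positivity
  have hA : A < Real.log (1 + K * (b - a) / d) / (2 * K) := by
    rw [lt_div_iff₀ (by positivity), Real.lt_log_iff_exp_lt (by positivity)]
    have h1 : d ≤ K * (b - a) / Real.exp (2 * K * A) := min_le_right _ _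
    rw [le_div_iff₀ (Real.exp_pos _)] at h1
    have h2 : Real.exp (2 * K * A) ≤ K * (b - a) / d := by
      rw [le_div_iff₀ hd]
      linarith
    rw [mul_comm A]
    linarith
  refine hA.trans_le ((log_le_integral_inv_dist hs₀ hK hd).trans ?_)
  have hF : Continuous (clampExtend a b f) := continuous_clampExtend hf.continuous
  have hy : ∀ s, 0 < f s₀ - clampExtend a b f s + d := fun s => by
    linarith [hmax (clampExtend_mem_image f hab.le s)]
  refine intervalIntegral.integral_mono_on hab.le ?_ ?_ ?_
  · refine (Continuous.div (by fun_prop) (by fun_prop) fun s => ?_).intervalIntegrable _ _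
    positivity
  · exact (continuous_recipSlope_comp (by fun_prop) hy).intervalIntegrable _ _
  · intro s hs
    refine le_trans ?_ (inv_le_recipSlope (hy s))
    have h3 := hlip s hs
    have h4 := hy s
    rw [clampExtend_of_mem f hs] at h4 ⊢
    gcongr

lemma IsDecSteadyNM.mapsTo {l ε : ℝ} {f : ℝ → ℝ} {um up : ℝ} {v v' : ℝ → ℝ} {c : ℝ}
    (h : IsDecSteadyNM l ε f um up v v' c) (hl : 0 < l) {x : ℝ} (hx : x ∈ Icc (-l) l) :
    v x ∈ Icc up um := by
  obtain ⟨hanti, -, -, h1, h2, -⟩ := h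
  have hll : -l ≤ l := by linarith
  exact ⟨h2 ▸ hanti.antitoneOn hx (right_mem_Icc.2 hll) hx.2,
    h1 ▸ hanti.antitoneOn (left_mem_Icc.2 hll) hx hx.1⟩

lemma IsDecSteadyNM.flux_mem {l ε : ℝ} {f : ℝ → ℝ} {um up : ℝ} {v v' : ℝ → ℝ} {c : ℝ}
    (h : IsDecSteadyNM l ε f um up v v' c) (hε : 0 < ε) {x : ℝ} (hx : x ∈ Icc (-l) l) :
    -(f (v x) + c) ∈ Ioo 0 (1 / 2) ∧ recipSlope (-(f (v x) + c)) * v' x = -1 / ε := by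
  obtain ⟨-, -, -, -, -, hb, heq⟩ := h
  have hs : ε * v' x ∈ Ioo (-1) 0 := by
    obtain ⟨h1, h2⟩ := hb x hx
    refine ⟨?_, mul_neg_of_pos_of_neg hε h2⟩
    have := mul_lt_mul_of_pos_left h1 hε
    rwa [mul_neg, mul_inv_cancel₀ hε.ne'] at this
  have h0 : v' x ≠ 0 := (hb x hx).2.ne
  have he := heq x hx
  rw [← mul_pow] at he
  rw [← he, recipSlope_flux hs]
  refine ⟨?_, by field_simp⟩
  have h3 : 0 < 1 + (ε * v' x) ^ 2 := by positivity
  rw [← neg_div]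
  refine ⟨div_pos (by linarith [hs.2]) h3, ?_⟩
  rw [div_lt_div_iff₀ h3 (by norm_num)]
  nlinarith [hs.1]

lemma IsDecSteadyNM.surj {l ε : ℝ} {f : ℝ → ℝ} {um up : ℝ} {v v' : ℝ → ℝ} {c : ℝ}
    (h : IsDecSteadyNM l ε f um up v v' c) (hl : 0 < l) {u : ℝ} (hu : u ∈ Icc up um) :
    ∃ x ∈ Icc (-l) l, v x = u := by
  obtain ⟨-, -, hd, h1, h2, -⟩ := h
  have hll : -l ≤ l := by linarith
  have hcont : ContinuousOn v (Icc (-l) l) := fun x hx => (hd x hx).continuousAt.continuousWithinAt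
  have := intermediate_value_Icc' hll hcont
  rw [h1, h2] at this
  exact this hu

/-- Along a solution, the primitive of `recipSlope` decreases at the constant rate `1 / ε`. -/
lemma IsDecSteadyNM.integral_eq {l ε : ℝ} {f : ℝ → ℝ} {um up : ℝ} {v v' : ℝ → ℝ} {c k : ℝ}
    (h : IsDecSteadyNM l ε f um up v v' c) (hε : 0 < ε) (hl : 0 < l) (hf : Continuous f)
    (hu : up < um) (hk : IsGreatest (f '' Icc up um) k) (hkc : k + c < 0) {x : ℝ}
    (hx : x ∈ Icc (-l) l) :
    transitTime (clampExtend up um f) up (v x) k (-(k + c)) = (l - x) / ε := by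
  set F := clampExtend up um f with hF_def
  have hF : Continuous F := continuous_clampExtend hf
  have hpos : ∀ s, 0 < k - F s + -(k + c) := fun s => by
    linarith [hk.2 (clampExtend_mem_image f hu.le s)]
  have hcont : Continuous fun s => recipSlope (k - F s + -(k + c)) :=
    continuous_recipSlope_comp (by fun_prop) hpos
  have hder : ∀ y ∈ Icc (-l) l, HasDerivAt
      (fun y => transitTime F up (v y) k (-(k + c)) + y / ε) 0 y := by
    intro y hy
    have h1 := (hcont.integral_hasStrictDerivAt up (v y)).hasDerivAt.comp y (h.2.2.1 y hy)
    have h2 := h1.add ((hasDerivAt_id y).div_const ε)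
    refine h2.congr_deriv ?_
    have h3 := (h.flux_mem hε hy).2
    rw [hF_def, clampExtend_of_mem f (h.mapsTo hl hy),
      show k - f (v y) + -(k + c) = -(f (v y) + c) by ring, h3]
    ring
  have hll : l ∈ Icc (-l) l := right_mem_Icc.2 (by linarith)
  have hconst := (convex_Icc (-l) l).is_const_of_fderivWithin_eq_zero
    (𝕜 := ℝ) (f := fun y => transitTime F up (v y) k (-(k + c)) + y / ε)
    (fun y hy => (hder y hy).differentiableAt.differentiableWithinAt)
    (fun y hy => by
      have h4 := (hder y hy).hasFDerivAt.hasFDerivWithinAt (s := Icc (-l) l)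
      rw [h4.fderivWithin (uniqueDiffOn_Icc (by linarith) y hy)]
      ext
      simp) hx hll
  have h5 : v l = up := h.2.2.2.2.1
  simp only [h5] at hconst
  rw [show transitTime F up up k (-(k + c)) = 0 from intervalIntegral.integral_same] at hconst
  rw [sub_div]
  linarith

lemma exists_isDecSteadyNM {l ε : ℝ} {f : ℝ → ℝ} {um up m M d : ℝ} (hε : 0 < ε)
    (hf : Continuous f) (hu : up < um) (hm : IsLeast (f '' Icc up um) m)
    (hM : IsGreatest (f '' Icc up um) M) (hd : 0 < d) (hd' : d < 1 / 2 - (M - m))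
    (ht : transitTime (clampExtend up um f) up um M d = 2 * l / ε) :
    ∃ v v', IsDecSteadyNM l ε f um up v v' (-(M + d)) := by
  set F := clampExtend up um f with hF_def
  have hF : Continuous F := continuous_clampExtend hf
  have hpos : ∀ s, 0 < M - F s + d := fun s => by
    linarith [hM.2 (clampExtend_mem_image f hu.le s)]
  have hlt : ∀ s, M - F s + d < 1 / 2 := fun s => by
    linarith [hm.2 (clampExtend_mem_image f hu.le s)]
  set h : ℝ → ℝ := fun s => recipSlope (M - F s + d)
  have hh : ∀ s, 1 < h s := fun s => one_lt_recipSlope (hpos s) (hlt s)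
  have hcont : Continuous h := continuous_recipSlope_comp (by fun_prop) hpos
  have hG : ∀ u, HasDerivAt (fun u => transitTime F up u M d) (h u) u := fun u =>
    (hcont.integral_hasStrictDerivAt up u).hasDerivAt
  obtain ⟨g, hg, hg'⟩ := exists_inverse_of_one_le_deriv (fun s => (hh s).le) hG
  have hgcont : Continuous g := continuous_iff_continuousAt.2 fun t => (hg' t).continuousAt
  have hv : ∀ x, HasDerivAt (fun x => g ((l - x) / ε)) (-(1 / h (g ((l - x) / ε))) / ε) x := by
    intro x
    have h1 := (hg' ((l - x) / ε)).comp x (((hasDerivAt_id x).const_sub l).div_const ε)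
    refine h1.congr_deriv ?_
    field_simp
  have hneg : ∀ x, -(1 / h (g ((l - x) / ε))) / ε < 0 := fun x => by
    have := one_pos.trans (hh (g ((l - x) / ε)))
    exact div_neg_of_neg_of_pos (neg_lt_zero.2 (by positivity)) hε
  have hanti : StrictAnti fun x => g ((l - x) / ε) :=
    strictAnti_of_deriv_neg fun x => by rw [(hv x).deriv]; exact hneg x
  have hleft : g ((l - -l) / ε) = um := by
    rw [show (l - -l) / ε = 2 * l / ε by ring, ← ht]
    exact hg um
  have hright : g ((l - l) / ε) = up := by
    have := hg up
    rwa [show transitTime F up up M d = 0 from intervalIntegral.integral_same,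
      ← zero_div ε, ← sub_self l] at this
  refine ⟨fun x => g ((l - x) / ε), fun x => -(1 / h (g ((l - x) / ε))) / ε,
    hanti.strictAntiOn _, ?_, fun x _ => hv x, hleft, hright, fun x _ => ⟨?_, hneg x⟩, ?_⟩
  · have hne : ∀ x, h (g ((l - x) / ε)) ≠ 0 := fun x => (one_pos.trans (hh _)).ne'
    have : Continuous fun x => h (g ((l - x) / ε)) := by fun_prop
    exact ((continuous_const.div this hne).neg.div_const ε).continuousOn
  · beta_reduce
    rw [neg_div, neg_lt_neg_iff, ← one_div]
    gcongr
    rw [div_lt_one (one_pos.trans (hh _))]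
    exact hh _
  · intro x hx
    have hmem : g ((l - x) / ε) ∈ Icc up um :=
      ⟨hright ▸ hanti.antitone hx.2, hleft ▸ hanti.antitone hx.1⟩
    have h1 := flux_inv_recipSlope (hpos (g ((l - x) / ε))) (hlt (g ((l - x) / ε)))
    rw [← mul_pow, mul_div_cancel₀ _ hε.ne']
    refine h1.trans ?_
    rw [hF_def, clampExtend_of_mem f hmem]
    ring

theorem stmt_3
    (ε l : ℝ) (hε : 0 < ε) (hl : 0 < l)
    (f : ℝ → ℝ) (hf : ContDiff ℝ 2 f)
    (um up : ℝ) (hu : up < um)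
    (m M B : ℝ)
    (hm : IsLeast (f '' Set.Icc up um) m)
    (hM : IsGreatest (f '' Set.Icc up um) M)
    (hB : B = ∫ s in up..um,
      (1 + 2 * Real.sqrt ((f s - m) * (1 - (f s - m)))) / (1 - 2 * (f s - m))) :
    ((∃ v v' c, IsDecSteadyNM l ε f um up v v' c) ∧
      ∀ v₁ v₁' c₁ v₂ v₂' c₂,
        IsDecSteadyNM l ε f um up v₁ v₁' c₁ →
        IsDecSteadyNM l ε f um up v₂ v₂' c₂ →
        Set.EqOn v₁ v₂ (Set.Icc (-l) l)) ↔
      (M - m < 1 / 2 ∧ 2 * l / ε > B) := by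
  set F := clampExtend up um f with hF_def
  have hF : Continuous F := continuous_clampExtend hf.continuous
  have hFM : ∀ s, F s ≤ M := fun s => hM.2 (clampExtend_mem_image f hu.le s)
  have hanti := transitTime_strictAntiOn hF hFM hu
  have hB' : B = transitTime F up um M (1 / 2 - (M - m)) := by
    rw [hB]
    refine intervalIntegral.integral_congr fun s hs => ?_
    rw [uIcc_of_le hu.le] at hs
    simp only [hF_def, clampExtend_of_mem f hs, recipSlope]
    rw [show 1 - 4 * (M - f s + (1 / 2 - (M - m))) ^ 2 =
      2 ^ 2 * ((f s - m) * (1 - (f s - m))) by ring,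
      Real.sqrt_mul (x := 2 ^ 2) (by norm_num), Real.sqrt_sq (by norm_num)]
    congr 1
    ring
  have hbounds : ∀ {v v' c}, IsDecSteadyNM l ε f um up v v' c →
      0 < -(M + c) ∧ -(M + c) < 1 / 2 - (M - m) ∧
        transitTime F up um M (-(M + c)) = 2 * l / ε := by
    intro v v' c h
    obtain ⟨a, ha, hfa⟩ := hM.1
    obtain ⟨b, hb, hfb⟩ := hm.1
    obtain ⟨x, hx, rfl⟩ := h.surj hl ha
    obtain ⟨y, hy, rfl⟩ := h.surj hl hb
    have h1 := (h.flux_mem hε hx).1.1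
    have h2 := (h.flux_mem hε hy).1.2
    rw [hfa] at h1
    rw [hfb] at h2
    refine ⟨h1, by linarith, ?_⟩
    have h3 := h.integral_eq hε hl hf.continuous hu hM (by linarith)
      (left_mem_Icc.2 (by linarith : -l ≤ l))
    rw [h.2.2.2.1] at h3
    rw [h3]
    ring
  constructor
  · rintro ⟨⟨v, v', c, h⟩, -⟩
    obtain ⟨h1, h2, h3⟩ := hbounds h
    refine ⟨by linarith, ?_⟩
    rw [hB', ← h3]
    exact hanti h1 (h1.trans h2) h2
  · rintro ⟨hMm, hlB⟩
    have hd₀ : 0 < 1 / 2 - (M - m) := by linarith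
    refine ⟨?_, ?_⟩
    · obtain ⟨δ, hδ, hδ', hlt⟩ := exists_lt_transitTime (hf.of_le (by norm_num)) hu hM
        (2 * l / ε) hd₀
      obtain ⟨d, hd, hdt⟩ := intermediate_value_Icc' hδ'
        ((transitTime_continuousOn (a := up) (b := um) hF hFM hδ).mono Icc_subset_Ici_self)
        ⟨hB' ▸ hlB.le, hlt.le⟩
      have hne : d ≠ 1 / 2 - (M - m) := by
        rintro rfl
        rw [hB', ← hdt] at hlB
        exact lt_irrefl _ hlB
      obtain ⟨v, v', hv⟩ := exists_isDecSteadyNM hε hf.continuous hu hm hM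
        (hδ.trans_le hd.1) (lt_of_le_of_ne hd.2 hne) hdt
      exact ⟨v, v', _, hv⟩
    · intro v₁ v₁' c₁ v₂ v₂' c₂ h₁ h₂ x hx
      obtain ⟨h11, -, h13⟩ := hbounds h₁
      obtain ⟨h21, -, h23⟩ := hbounds h₂
      have hc : c₁ = c₂ := by
        have := hanti.injOn h11 h21 (h13.trans h23.symm)
        linarith
      subst hc
      have hpos : ∀ s, 0 < M - F s + -(M + c₁) := fun s => by linarith [hFM s]
      have hcont : Continuous fun s => recipSlope (M - F s + -(M + c₁)) :=
        continuous_recipSlope_comp (by fun_prop) hpos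
      have hmono : StrictMono fun u => transitTime F up u M (-(M + c₁)) :=
        strictMono_of_deriv_pos fun u => by
          rw [show deriv (fun u => transitTime F up u M (-(M + c₁))) u =
            recipSlope (M - F u + -(M + c₁)) from
              (hcont.integral_hasStrictDerivAt up u).hasDerivAt.deriv]
          exact lt_of_lt_of_le (by have := hpos u; positivity) (inv_le_recipSlope (hpos u))
      exact hmono.injective ((h₁.integral_eq hε hl hf.continuous hu hM (by linarith) hx).trans
        (h₂.integral_eq hε hl hf.continuous hu hM (by linarith) hx).symm)
end

section
/- Let ε>0, ℓ>0, f ∈ C²(ℝ) and u_+ > u_-. Then there exists a unique strictly increasing C¹ function v on [−ℓ,ℓ] with v(−ℓ)=u_-, v(ℓ)=u_+, satisfying 0 < ε v'(x) < 1 for all x, for which there is a constant c∈ℝ such that ε v'(x)/√(1−ε² v'(x)²) = f(v(x)) + c for all x∈[−ℓ,ℓ] (i.e., v is a smooth increasing solution of (ε v_x/√(1−ε² v_x²))_x = (f(v))_x with v(±ℓ)=u_±), if and only if 2ℓ/ε > u_+ − u_-. -/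
open Set Filter Topology MeasureTheory

/-- `v` (with derivative `v'`) is a strictly increasing C¹ solution, with `0 < ε v' < 1`,
of the stationary problem `(ε v_x/√(1-ε²v_x²))_x = (f(v))_x`, `v(±ℓ)=u_±`, i.e. there is a
constant `c` with `ε v'/√(1-ε²v'²) = f(v) + c` on `[-ℓ,ℓ]`. -/
def IsIncSteadyMink (l ε : ℝ) (f : ℝ → ℝ) (um up : ℝ) (v v' : ℝ → ℝ) (c : ℝ) : Prop :=
  StrictMonoOn v (Set.Icc (-l) l) ∧
  ContinuousOn v' (Set.Icc (-l) l) ∧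
  (∀ x ∈ Set.Icc (-l) l, HasDerivAt v (v' x) x) ∧
  v (-l) = um ∧ v l = up ∧
  (∀ x ∈ Set.Icc (-l) l, 0 < ε * v' x ∧ ε * v' x < 1) ∧
  ∀ x ∈ Set.Icc (-l) l, ε * v' x / Real.sqrt (1 - ε ^ 2 * v' x ^ 2) = f (v x) + c

/-- The reciprocal of the slope `s` determined by `s / √(1 - s ^ 2) = y`. -/
noncomputable def slowness (y : ℝ) : ℝ := Real.sqrt (1 + (y⁻¹) ^ 2)

lemma one_le_slowness (y : ℝ) : 1 ≤ slowness y := by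
  rw [slowness, Real.le_sqrt zero_le_one (by positivity)]
  nlinarith [sq_nonneg y⁻¹]

lemma slowness_pos (y : ℝ) : 0 < slowness y := one_pos.trans_le (one_le_slowness y)

lemma sq_slowness (y : ℝ) : slowness y ^ 2 = 1 + (y⁻¹) ^ 2 := Real.sq_sqrt (by positivity)

lemma inv_le_slowness (y : ℝ) : y⁻¹ ≤ slowness y := by
  refine Real.le_sqrt_of_sq_le ?_
  linarith

lemma slowness_le {y : ℝ} (hy : 0 < y) : slowness y ≤ 1 + y⁻¹ := by
  rw [slowness, Real.sqrt_le_left (by positivity)]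
  have := inv_pos.2 hy
  nlinarith

lemma slowness_lt {x y : ℝ} (hx : 0 < x) (hxy : x < y) : slowness y < slowness x := by
  have h : y⁻¹ < x⁻¹ := inv_strictAnti₀ hx hxy
  have : 0 < y⁻¹ := inv_pos.2 (hx.trans hxy)
  exact Real.sqrt_lt_sqrt (by positivity) (by gcongr)

lemma slowness_comp_continuous {X : Type*} [TopologicalSpace X] {h : X → ℝ} (hc : Continuous h)
    (hpos : ∀ u, 0 < h u) : Continuous fun u => slowness (h u) := by
  unfold slowness
  exact ((continuous_const.add ((hc.inv₀ fun u => (hpos u).ne').pow 2))).sqrt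

lemma mul_slowness_eq_one {s y : ℝ} (h0 : 0 < s) (h1 : s < 1)
    (h : s / Real.sqrt (1 - s ^ 2) = y) : 0 < y ∧ s * slowness y = 1 := by
  have hp : 0 < 1 - s ^ 2 := by nlinarith
  have hr := Real.sqrt_pos.2 hp
  have hsq := Real.sq_sqrt hp.le
  refine ⟨h ▸ by positivity, ?_⟩
  have h2 : slowness y = s⁻¹ := by
    rw [slowness, Real.sqrt_eq_iff_mul_self_eq_of_pos (by positivity), ← h, inv_div, div_pow, hsq]
    field_simp
    ring
  rw [h2, mul_inv_cancel₀ h0.ne']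

lemma inv_slowness_div_sqrt {y : ℝ} (hy : 0 < y) :
    0 < (slowness y)⁻¹ ∧ (slowness y)⁻¹ < 1 ∧
      (slowness y)⁻¹ / Real.sqrt (1 - (slowness y)⁻¹ ^ 2) = y := by
  have hw := slowness_pos y
  have h2 := sq_slowness y
  have hy' := inv_pos.2 hy
  refine ⟨inv_pos.2 hw, inv_lt_one_of_one_lt₀ ?_, ?_⟩
  · nlinarith [sq_pos_of_pos hy']
  · have : Real.sqrt (1 - (slowness y)⁻¹ ^ 2) = (y * slowness y)⁻¹ := by
      rw [Real.sqrt_eq_iff_mul_self_eq_of_pos (by positivity)]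
      rw [← sq, mul_inv, mul_pow, inv_pow (slowness y), h2]
      field_simp
      ring
    rw [this]
    field_simp

lemma log_le_integral_slowness {p q K δ : ℝ} (hpq : p < q) (hK : 0 < K) (hδ : 0 < δ)
    {h : ℝ → ℝ} (hc : Continuous h) (hpos : ∀ u, 0 < h u)
    (hle : ∀ u ∈ Icc p q, h u ≤ K * (u - p) + δ) :
    (Real.log (K * (q - p)) - Real.log δ) / K ≤ ∫ u in p..q, slowness (h u) := by
  have hden : ∀ u ∈ Icc p q, 0 < K * (u - p) + δ := fun u hu => by
    have := mul_nonneg hK.le (sub_nonneg.2 hu.1)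
    linarith
  have hcont : ContinuousOn (fun u => (K * (u - p) + δ)⁻¹) (uIcc p q) := by
    rw [uIcc_of_le hpq.le]
    exact ContinuousOn.inv₀ (by fun_prop) fun u hu => (hden u hu).ne'
  have hintegral : ∫ u in p..q, (K * (u - p) + δ)⁻¹ =
      Real.log (K * (q - p) + δ) / K - Real.log (K * (p - p) + δ) / K := by
    refine intervalIntegral.integral_eq_sub_of_hasDerivAt
      (f := fun u => Real.log (K * (u - p) + δ) / K) (fun u hu => ?_) hcont.intervalIntegrable
    rw [uIcc_of_le hpq.le] at hu
    have hd : HasDerivAt (fun u => K * (u - p) + δ) K u := by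
      simpa using (((hasDerivAt_id u).sub_const p).const_mul K).add_const δ
    have := (hd.log (hden u hu).ne').div_const K
    rwa [div_right_comm, div_self hK.ne', one_div] at this
  have hmono : ∫ u in p..q, (K * (u - p) + δ)⁻¹ ≤ ∫ u in p..q, slowness (h u) := by
    refine intervalIntegral.integral_mono_on hpq.le hcont.intervalIntegrable
      ((slowness_comp_continuous hc hpos).intervalIntegrable _ _) fun u hu => ?_
    exact (inv_anti₀ (hpos u) (hle u hu)).trans (inv_le_slowness _)
  have hKq : 0 < K * (q - p) := mul_pos hK (sub_pos.2 hpq)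
  have hlog : Real.log (K * (q - p)) ≤ Real.log (K * (q - p) + δ) :=
    Real.log_le_log hKq (by linarith)
  refine le_trans ?_ hmono
  rw [hintegral, sub_self, mul_zero, zero_add, ← sub_div]
  gcongr

lemma log_le_integral_slowness_left {p q K δ : ℝ} (hpq : p < q) (hK : 0 < K) (hδ : 0 < δ)
    {h : ℝ → ℝ} (hc : Continuous h) (hpos : ∀ u, 0 < h u)
    (hle : ∀ u ∈ Icc p q, h u ≤ K * (q - u) + δ) :
    (Real.log (K * (q - p)) - Real.log δ) / K ≤ ∫ u in p..q, slowness (h u) := by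
  have key := log_le_integral_slowness hpq hK hδ (h := fun u => h (p + q - u))
    (by fun_prop) (fun u => hpos _) fun u hu => by
      refine (hle (p + q - u) ⟨by linarith [hu.2], by linarith [hu.1]⟩).trans_eq ?_
      ring
  refine key.trans_eq ?_
  rw [intervalIntegral.integral_comp_sub_left (fun u => slowness (h u))]
  congr 1 <;> ring

lemma exists_le_integral_slowness {a b u₀ K : ℝ} (hab : a < b) (hu₀ : u₀ ∈ Icc a b) (hK : 0 < K)
    {F : ℝ → ℝ} (hF : Continuous F) (hmin : ∀ u, F u₀ ≤ F u)
    (hlip : ∀ u ∈ Icc a b, F u ≤ F u₀ + K * |u - u₀|) (B : ℝ) :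
    ∃ c, 0 < F u₀ + c ∧ B ≤ ∫ u in a..b, slowness (F u + c) := by
  set L := (b - a) / 2 with hL
  have hLpos : 0 < L := by rw [hL]; linarith
  have hKL : 0 < K * L := mul_pos hK hLpos
  set δ := K * L * Real.exp (-(K * B)) with hδdef
  have hδ : 0 < δ := by positivity
  have hlogδ : Real.log δ = Real.log (K * L) - K * B := by
    rw [hδdef, Real.log_mul hKL.ne' (Real.exp_pos _).ne', Real.log_exp]
    ring
  have hbound : ∀ r, L ≤ r → B ≤ (Real.log (K * r) - Real.log δ) / K := fun r hr => by
    have : Real.log (K * L) ≤ Real.log (K * r) := Real.log_le_log hKL (by gcongr)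
    rw [le_div_iff₀ hK, hlogδ]
    linarith
  have hcont : Continuous fun u => F u + (δ - F u₀) := by fun_prop
  have hpos : ∀ u, 0 < F u + (δ - F u₀) := fun u => by linarith [hmin u]
  have hintegral : ∀ p q, IntervalIntegrable (fun u => slowness (F u + (δ - F u₀))) volume p q :=
    fun p q => (slowness_comp_continuous hcont hpos).intervalIntegrable _ _
  have hsplit := intervalIntegral.integral_add_adjacent_intervals (hintegral a u₀) (hintegral u₀ b)
  have hl := intervalIntegral.integral_nonneg (μ := volume) hu₀.1
    fun u _ => (slowness_pos (F u + (δ - F u₀))).le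
  have hr := intervalIntegral.integral_nonneg (μ := volume) hu₀.2
    fun u _ => (slowness_pos (F u + (δ - F u₀))).le
  refine ⟨δ - F u₀, by linarith, ?_⟩
  rcases le_total L (b - u₀) with h | h
  · have := log_le_integral_slowness (p := u₀) (q := b) (by linarith) hK hδ hcont hpos
      fun u hu => by
        have := hlip u ⟨hu₀.1.trans hu.1, hu.2⟩
        rw [abs_of_nonneg (sub_nonneg.2 hu.1)] at this
        linarith
    linarith [hbound _ h]
  · have h' : L ≤ u₀ - a := by rw [hL] at h ⊢; linarith
    have := log_le_integral_slowness_left (p := a) (q := u₀) (by linarith) hK hδ hcont hpos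
      fun u hu => by
        have := hlip u ⟨hu.1, hu.2.trans hu₀.2⟩
        rw [abs_of_nonpos (sub_nonpos.2 hu.2)] at this
        linarith
    linarith [hbound _ h']

lemma exists_integral_slowness_le {a b m η : ℝ} (hab : a < b) (hη : 0 < η)
    {F : ℝ → ℝ} (hF : Continuous F) (hmin : ∀ u, m ≤ F u) :
    ∃ c₀, ∀ c, c₀ ≤ c → ∫ u in a..b, slowness (F u + c) ≤ b - a + η := by
  have hba : 0 < b - a := sub_pos.2 hab
  refine ⟨(b - a) / η - m, fun c hc => ?_⟩
  have hN : 0 < (b - a) / η := by positivity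
  have hge : ∀ u, (b - a) / η ≤ F u + c := fun u => by linarith [hmin u]
  have hpos : ∀ u, 0 < F u + c := fun u => hN.trans_le (hge u)
  have hmono : ∫ u in a..b, slowness (F u + c) ≤ ∫ _ in a..b, (1 + ((b - a) / η)⁻¹) := by
    refine intervalIntegral.integral_mono_on hab.le
      ((slowness_comp_continuous (by fun_prop) hpos).intervalIntegrable _ _)
      intervalIntegrable_const fun u _ => (slowness_le (hpos u)).trans ?_
    gcongr
    exact hge u
  refine hmono.trans_eq ?_
  rw [intervalIntegral.integral_const, smul_eq_mul]
  field_simp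

lemma exists_integral_slowness_eq {a b u₀ K T : ℝ} (hab : a < b) (hu₀ : u₀ ∈ Icc a b) (hK : 0 < K)
    {F : ℝ → ℝ} (hF : Continuous F) (hmin : ∀ u, F u₀ ≤ F u)
    (hlip : ∀ u ∈ Icc a b, F u ≤ F u₀ + K * |u - u₀|) (hT : b - a < T) :
    ∃ c, (∀ u, 0 < F u + c) ∧ ∫ u in a..b, slowness (F u + c) = T := by
  obtain ⟨c₁, hc₁, hB⟩ := exists_le_integral_slowness hab hu₀ hK hF hmin hlip T
  obtain ⟨c₂, hc₂⟩ := exists_integral_slowness_le hab (sub_pos.2 hT) hF hmin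
  have hpos : ∀ c u, 0 < F u + max c c₁ := fun c u => by linarith [hmin u, le_max_right c c₁]
  have hcont : Continuous fun c => ∫ u in a..b, slowness (F u + max c c₁) := by
    refine intervalIntegral.continuous_parametric_intervalIntegral_of_continuous' ?_ a b
    exact slowness_comp_continuous (h := fun x : ℝ × ℝ => F x.2 + max x.1 c₁) (by fun_prop)
      fun x => hpos _ _
  obtain ⟨c, hc⟩ := mem_range_of_exists_le_of_exists_ge hcont (c := T)
    ⟨c₂, (hc₂ _ (le_max_left _ _)).trans_eq (by ring)⟩ ⟨c₁, by simpa using hB⟩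
  exact ⟨max c c₁, hpos c, hc⟩

lemma hasDerivAt_integral_mul_slowness {ε a : ℝ} {h : ℝ → ℝ} (hc : Continuous h)
    (hpos : ∀ u, 0 < h u) (y : ℝ) :
    HasDerivAt (fun y => ∫ u in a..y, ε * slowness (h u)) (ε * slowness (h y)) y := by
  have : Continuous fun u => ε * slowness (h u) :=
    continuous_const.mul (slowness_comp_continuous hc hpos)
  exact intervalIntegral.integral_hasDerivAt_right (this.intervalIntegrable _ _)
    (this.stronglyMeasurableAtFilter _ _) this.continuousAt

lemma strictMono_integral_mul_slowness {ε a : ℝ} (hε : 0 < ε) {h : ℝ → ℝ} (hc : Continuous h)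
    (hpos : ∀ u, 0 < h u) : StrictMono fun y => ∫ u in a..y, ε * slowness (h u) :=
  strictMono_of_hasDerivAt_pos (hasDerivAt_integral_mul_slowness hc hpos)
    fun _ => mul_pos hε (slowness_pos _)

lemma exists_hasDerivAt_inverse {G g : ℝ → ℝ} {ε : ℝ} (hε : 0 < ε) (hG : ∀ y, HasDerivAt G (g y) y)
    (hg : ∀ y, ε ≤ g y) :
    ∃ v : ℝ → ℝ, StrictMono v ∧ (∀ y, v (G y) = y) ∧ (∀ x, HasDerivAt v (g (v x))⁻¹ x) := by
  have hgpos : ∀ y, 0 < g y := fun y => hε.trans_le (hg y)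
  have hmono : StrictMono G := strictMono_of_hasDerivAt_pos hG hgpos
  have hGc : Continuous G := continuous_iff_continuousAt.2 fun y => (hG y).continuousAt
  have hsub : Monotone fun y => G y - ε * y := by
    refine monotone_of_hasDerivAt_nonneg (f' := fun y => g y - ε) (fun y => ?_)
      fun y => sub_nonneg.2 (hg y)
    have := (hasDerivAt_id y).const_mul ε
    rw [mul_one] at this
    exact (hG y).sub this
  have htop : Tendsto G atTop atTop := by
    refine tendsto_atTop_mono' _ (f₁ := fun y => G 0 + ε * y) ?_
      (tendsto_atTop_add_const_left _ _ (tendsto_id.const_mul_atTop hε))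
    filter_upwards [eventually_ge_atTop 0] with y hy
    have := hsub hy
    simp only [mul_zero, sub_zero] at this
    linarith
  have hbot : Tendsto G atBot atBot := by
    refine tendsto_atBot_mono' _ (f₁ := fun y => G 0 + ε * y) ?_
      (tendsto_atBot_add_const_left _ _ (tendsto_id.const_mul_atBot hε))
    filter_upwards [eventually_le_atBot 0] with y hy
    have := hsub hy
    simp only [mul_zero, sub_zero] at this
    linarith
  let e := hmono.orderIsoOfSurjective G (hGc.surjective htop hbot)
  have he : ∀ x, G (e.symm x) = x := fun x => e.apply_symm_apply x
  refine ⟨e.symm, e.symm.strictMono, fun y => e.symm_apply_apply y, fun x => ?_⟩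
  exact HasDerivAt.of_local_left_inverse e.symm.continuous.continuousAt (hG _) (hgpos _).ne'
    (Eventually.of_forall he)

lemma exists_isIncSteadyMink {ε l um up c : ℝ} (hε : 0 < ε) {f F : ℝ → ℝ}
    (hF : Continuous F) (hfF : ∀ u ∈ Icc um up, F u = f u) (hpos : ∀ u, 0 < F u + c)
    (hT : ∫ u in um..up, ε * slowness (F u + c) = 2 * l) :
    ∃ v v' c, IsIncSteadyMink l ε f um up v v' c := by
  have hc : Continuous fun u => F u + c := by fun_prop
  obtain ⟨v, hv, hinv, hder⟩ := exists_hasDerivAt_inverse hε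
    (G := fun y => (∫ u in um..y, ε * slowness (F u + c)) - l)
    (fun y => (hasDerivAt_integral_mul_slowness hc hpos y).sub_const l)
    (fun y => le_mul_of_one_le_right hε.le (one_le_slowness _))
  have hl : v (-l) = um := by simpa using hinv um
  have hr : v l = up := by
    have := hinv up
    rw [hT] at this
    rwa [two_mul, add_sub_cancel_right] at this
  have hvc : Continuous v := continuous_iff_continuousAt.2 fun x => (hder x).continuousAt
  have hε' : ∀ y, ε * (ε * slowness y)⁻¹ = (slowness y)⁻¹ := fun y => by
    field_simp
  refine ⟨v, _, c, hv.strictMonoOn _, Continuous.continuousOn ?_, fun x _ => hder x, hl, hr,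
    fun x _ => ?_, fun x hx => ?_⟩
  · have := slowness_comp_continuous (hc.comp hvc) fun x => hpos (v x)
    exact (continuous_const.mul this).inv₀ fun x => (mul_pos hε (slowness_pos _)).ne'
  · rw [hε']
    exact ⟨(inv_slowness_div_sqrt (hpos _)).1, (inv_slowness_div_sqrt (hpos _)).2.1⟩
  · rw [← mul_pow, hε', (inv_slowness_div_sqrt (hpos _)).2.2, hfF _
      ⟨hl ▸ hv.monotone hx.1, hr ▸ hv.monotone hx.2⟩]

namespace IsIncSteadyMink

variable {l ε um up c : ℝ} {f v v' : ℝ → ℝ}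

lemma sub_lt (h : IsIncSteadyMink l ε f um up v v' c) (hε : 0 < ε) (hl : 0 < l) :
    up - um < 2 * l / ε := by
  obtain ⟨-, -, hd, h1, h2, hs, -⟩ := h
  obtain ⟨x, hx, hxe⟩ := exists_hasDerivAt_eq_slope v v' (by linarith : -l < l)
    (fun x hx => (hd x hx).continuousAt.continuousWithinAt)
    fun x hx => hd x (Ioo_subset_Icc_self hx)
  have := (hs x (Ioo_subset_Icc_self hx)).2
  rw [h1, h2, eq_div_iff (by linarith)] at hxe
  rw [lt_div_iff₀ hε, ← hxe]
  nlinarith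

lemma mapsTo (h : IsIncSteadyMink l ε f um up v v' c) (hl : 0 < l) :
    MapsTo v (Icc (-l) l) (Icc um up) := by
  obtain ⟨hm, -, -, h1, h2, -, -⟩ := h
  intro x hx
  have hle : -l ≤ l := by linarith
  exact ⟨h1 ▸ hm.monotoneOn (left_mem_Icc.2 hle) hx hx.1,
    h2 ▸ hm.monotoneOn hx (right_mem_Icc.2 hle) hx.2⟩

lemma add_pos (h : IsIncSteadyMink l ε f um up v v' c) (hl : 0 < l) {u : ℝ}
    (hu : u ∈ Icc um up) : 0 < f u + c := by
  obtain ⟨-, -, hd, h1, h2, hs, he⟩ := h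
  obtain ⟨x, hx, rfl⟩ := intermediate_value_Icc (by linarith : -l ≤ l)
    (fun x hx => (hd x hx).continuousAt.continuousWithinAt) (by rwa [h1, h2])
  have := he x hx
  rw [← mul_pow] at this
  exact (mul_slowness_eq_one (hs x hx).1 (hs x hx).2 this).1

lemma integral_eq (h : IsIncSteadyMink l ε f um up v v' c) (hl : 0 < l) {F : ℝ → ℝ}
    (hF : Continuous F) (hfF : ∀ u ∈ Icc um up, F u = f u) (hpos : ∀ u, 0 < F u + c)
    {x : ℝ} (hx : x ∈ Icc (-l) l) : ∫ u in um..v x, ε * slowness (F u + c) = x + l := by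
  have hmaps := h.mapsTo hl
  obtain ⟨-, -, hd, h1, -, hs, he⟩ := h
  have hc : Continuous fun u => F u + c := by fun_prop
  have hder : ∀ y ∈ Icc (-l) l,
      HasDerivAt (fun y => ∫ u in um..v y, ε * slowness (F u + c)) 1 y := fun y hy => by
    have := he y hy
    rw [← mul_pow, ← hfF _ (hmaps hy)] at this
    have := (mul_slowness_eq_one (hs y hy).1 (hs y hy).2 this).2
    rw [mul_right_comm] at this
    rw [← this]
    exact (hasDerivAt_integral_mul_slowness hc hpos (v y)).comp y (hd y hy)
  have := intervalIntegral.integral_eq_sub_of_hasDerivAt (a := -l) (b := x) (f' := fun _ => (1 : ℝ))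
    (fun y hy => hder y (by
      rw [uIcc_of_le hx.1] at hy
      exact ⟨hy.1, hy.2.trans hx.2⟩)) intervalIntegrable_const
  rw [h1, intervalIntegral.integral_same, intervalIntegral.integral_const] at this
  simp only [smul_eq_mul, mul_one, sub_zero, sub_neg_eq_add] at this
  exact this.symm

lemma const_le {c₁ c₂ : ℝ} {v₁ v₁' v₂ v₂' F : ℝ → ℝ} (hε : 0 < ε) (hl : 0 < l) (hu : um < up)
    (hF : Continuous F) (hfF : ∀ u ∈ Icc um up, F u = f u)
    (hp₁ : ∀ u, 0 < F u + c₁) (hp₂ : ∀ u, 0 < F u + c₂)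
    (h₁ : IsIncSteadyMink l ε f um up v₁ v₁' c₁)
    (h₂ : IsIncSteadyMink l ε f um up v₂ v₂' c₂) : c₁ ≤ c₂ := by
  by_contra! hlt
  have hmem : l ∈ Icc (-l) l := ⟨by linarith, le_rfl⟩
  have e₁ := h₁.integral_eq hl hF hfF hp₁ hmem
  have e₂ := h₂.integral_eq hl hF hfF hp₂ hmem
  rw [h₁.2.2.2.2.1] at e₁
  rw [h₂.2.2.2.2.1] at e₂
  have hcont : ∀ {c}, (∀ u, 0 < F u + c) → Continuous fun u => ε * slowness (F u + c) :=
    fun hp => continuous_const.mul (slowness_comp_continuous (by fun_prop) hp)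
  have hltu : ∀ u, ε * slowness (F u + c₁) < ε * slowness (F u + c₂) := fun u =>
    mul_lt_mul_of_pos_left (slowness_lt (hp₂ u) (by linarith)) hε
  have := intervalIntegral.integral_lt_integral_of_continuousOn_of_le_of_exists_lt hu
    (hcont hp₁).continuousOn (hcont hp₂).continuousOn (fun u _ => (hltu u).le)
    ⟨um, left_mem_Icc.2 hu.le, hltu um⟩
  linarith

end IsIncSteadyMink

theorem stmt_7
    (ε l : ℝ) (hε : 0 < ε) (hl : 0 < l)
    (f : ℝ → ℝ) (hf : ContDiff ℝ 2 f)
    (um up : ℝ) (hu : um < up) :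
    ((∃ v v' c, IsIncSteadyMink l ε f um up v v' c) ∧
      ∀ v₁ v₁' c₁ v₂ v₂' c₂,
        IsIncSteadyMink l ε f um up v₁ v₁' c₁ →
        IsIncSteadyMink l ε f um up v₂ v₂' c₂ →
        Set.EqOn v₁ v₂ (Set.Icc (-l) l)) ↔
      2 * l / ε > up - um := by
  constructor
  · rintro ⟨⟨v, v', c, h⟩, -⟩
    exact h.sub_lt hε hl
  intro hT
  set F : ℝ → ℝ := fun u => f (projIcc um up hu.le u) with hFdef
  have hF : Continuous F := hf.continuous.comp (continuous_subtype_val.comp continuous_projIcc)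
  have hfF : ∀ u ∈ Icc um up, F u = f u := fun u hu' => by
    simp only [hFdef, projIcc_of_mem hu.le hu']
  refine ⟨?_, fun v₁ v₁' c₁ v₂ v₂' c₂ h₁ h₂ x hx => ?_⟩
  · obtain ⟨u₀, hu₀, hmin⟩ := isCompact_Icc.exists_isMinOn (nonempty_Icc.2 hu.le)
      hf.continuous.continuousOn
    obtain ⟨K, hK⟩ := hf.contDiffOn.exists_lipschitzOnWith two_ne_zero (convex_Icc um up)
      isCompact_Icc
    have hT' : up - um < 2 * l / ε := hT
    obtain ⟨c, hpos, hc⟩ := exists_integral_slowness_eq hu hu₀ (K := K + 1) (by positivity) hF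
      (fun u => by
        rw [hfF u₀ hu₀]
        exact hmin (projIcc um up hu.le u).2)
      (fun u hu' => by
        have := hK.dist_le_mul u hu' u₀ hu₀
        rw [Real.dist_eq, Real.dist_eq] at this
        rw [hfF u hu', hfF u₀ hu₀]
        linarith [le_abs_self (f u - f u₀), abs_nonneg (u - u₀)]) hT'
    refine exists_isIncSteadyMink hε hF hfF hpos ?_
    rw [intervalIntegral.integral_const_mul, hc]
    field_simp
  · have hp₁ : ∀ u, 0 < F u + c₁ := fun u => h₁.add_pos hl (projIcc um up hu.le u).2
    have hp₂ : ∀ u, 0 < F u + c₂ := fun u => h₂.add_pos hl (projIcc um up hu.le u).2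
    have hcc : c₁ = c₂ := le_antisymm
      (IsIncSteadyMink.const_le hε hl hu hF hfF hp₁ hp₂ h₁ h₂)
      (IsIncSteadyMink.const_le hε hl hu hF hfF hp₂ hp₁ h₂ h₁)
    subst hcc
    refine (strictMono_integral_mul_slowness (a := um) hε (h := fun u => F u + c₁)
      (by fun_prop) hp₁).injective ?_
    exact (h₁.integral_eq hl hF hfF hp₁ hx).trans (h₂.integral_eq hl hF hfF hp₁ hx).symm
end

section
/- Let f ∈ C²(ℝ), u_+ > u_-, and set m = min_{u∈[u_-,u_+]} f(u). Then the function Φ(c) = ∫_{u_-}^{u_+} √(1+(f(s)+c)²)/(f(s)+c) ds, defined for c ∈ (−m, +∞), is strictly decreasing, lim_{c→(−m)^+} Φ(c) = +∞, and lim_{c→+∞} Φ(c) = u_+ − u_-. Consequently, for every r > u_+ − u_- there exists a unique c_* > −m with Φ(c_*) = r. -/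
open Set Filter Topology MeasureTheory

theorem sqrt_one_add_sq_div_strictAntiOn :
    StrictAntiOn (fun x : ℝ => Real.sqrt (1 + x ^ 2) / x) (Ioi 0) := by
  intro x hx y hy hxy
  have hx : 0 < x := hx
  have hy : 0 < y := hy
  change Real.sqrt (1 + y ^ 2) / y < Real.sqrt (1 + x ^ 2) / x
  rw [div_lt_div_iff₀ hy hx]
  refine lt_of_pow_lt_pow_left₀ 2 (by positivity) ?_
  rw [mul_pow, mul_pow, Real.sq_sqrt (by positivity), Real.sq_sqrt (by positivity)]
  nlinarith

theorem one_le_sqrt_one_add_sq_div {x : ℝ} (hx : 0 < x) : 1 ≤ Real.sqrt (1 + x ^ 2) / x := by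
  rw [one_le_div hx]
  exact Real.le_sqrt_of_sq_le (by linarith)

theorem inv_le_sqrt_one_add_sq_div {x : ℝ} (hx : 0 < x) : 1 / x ≤ Real.sqrt (1 + x ^ 2) / x := by
  gcongr
  exact Real.le_sqrt_of_sq_le (by nlinarith)

theorem sqrt_one_add_sq_div_le {x : ℝ} (hx : 0 < x) : Real.sqrt (1 + x ^ 2) / x ≤ 1 + 1 / x := by
  rw [div_le_iff₀ hx, add_mul, one_div_mul_cancel hx.ne']
  exact Real.sqrt_le_iff.2 ⟨by linarith, by nlinarith⟩

theorem integral_one_div_linear {K δ a b : ℝ} (hK : 0 < K) (hδ : 0 < δ) (hab : a ≤ b) :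
    ∫ s in a..b, 1 / (K * (s - a) + δ) = (Real.log (K * (b - a) + δ) - Real.log δ) / K := by
  have hpos : ∀ s ∈ uIcc a b, 0 < K * (s - a) + δ := by
    intro s hs
    rw [uIcc_of_le hab] at hs
    have := mul_nonneg hK.le (sub_nonneg.2 hs.1)
    linarith
  rw [intervalIntegral.integral_eq_sub_of_hasDerivAt
    (f := fun s => Real.log (K * (s - a) + δ) / K)]
  · simp [sub_div]
  · intro s hs
    have h : HasDerivAt (fun s => K * (s - a) + δ) K s := by
      simpa using (((hasDerivAt_id s).sub_const a).const_mul K).add_const δ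
    have h' := (h.log (hpos s hs).ne').div_const K
    rwa [div_right_comm, div_self hK.ne'] at h'
  · refine ContinuousOn.intervalIntegrable ?_
    exact continuousOn_const.div (by fun_prop) fun s hs => (hpos s hs).ne'

theorem log_le_integral_one_div_abs {K δ a b x : ℝ} (hK : 0 < K) (hδ : 0 < δ)
    (hx : x ∈ Icc a b) (hab : a < b) :
    (Real.log (K * (b - a)) - Real.log δ) / K ≤ ∫ s in a..b, 1 / (K * |s - x| + δ) := by
  have hcont : Continuous fun s => 1 / (K * |s - x| + δ) :=
    continuous_const.div (by fun_prop) fun s => by positivity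
  have hr : ∫ s in x..b, 1 / (K * |s - x| + δ)
      = (Real.log (K * (b - x) + δ) - Real.log δ) / K := by
    rw [← integral_one_div_linear hK hδ hx.2]
    refine intervalIntegral.integral_congr fun s hs => ?_
    rw [uIcc_of_le hx.2] at hs
    simp only [abs_of_nonneg (sub_nonneg.2 hs.1)]
  have hl : ∫ s in a..x, 1 / (K * |s - x| + δ)
      = (Real.log (K * (x - a) + δ) - Real.log δ) / K := by
    have h := intervalIntegral.integral_comp_neg (a := -x) (b := -a)
      fun s => 1 / (K * |s - x| + δ)
    rw [neg_neg, neg_neg] at h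
    have h' := integral_one_div_linear hK hδ (neg_le_neg hx.1)
    rw [← h, show x - a = -a - -x by ring, ← h']
    refine intervalIntegral.integral_congr fun s hs => ?_
    rw [uIcc_of_le (neg_le_neg hx.1)] at hs
    have : |-s - x| = s - -x := by
      rw [abs_of_nonpos (by linarith [hs.1])]; ring
    simp only [this]
  rw [← intervalIntegral.integral_add_adjacent_intervals (hcont.intervalIntegrable a x)
    (hcont.intervalIntegrable x b), hl, hr, ← add_div]
  have hA : 0 ≤ K * (x - a) := mul_nonneg hK.le (sub_nonneg.2 hx.1)
  have hB : 0 ≤ K * (b - x) := mul_nonneg hK.le (sub_nonneg.2 hx.2)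
  have hlog : Real.log (K * (b - a)) + Real.log δ
      ≤ Real.log (K * (x - a) + δ) + Real.log (K * (b - x) + δ) := by
    have hKba : 0 < K * (b - a) := mul_pos hK (sub_pos.2 hab)
    rw [← Real.log_mul hKba.ne' hδ.ne', ← Real.log_mul (by positivity) (by positivity)]
    refine Real.log_le_log (by positivity) ?_
    nlinarith [mul_nonneg hA hB]
  gcongr
  linarith

theorem stmt_8
    (f : ℝ → ℝ) (hf : ContDiff ℝ 2 f)
    (um up : ℝ) (hu : um < up)
    (m : ℝ) (hm : IsLeast (f '' Set.Icc um up) m) :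
    StrictAntiOn (fun c => ∫ s in um..up, Real.sqrt (1 + (f s + c) ^ 2) / (f s + c))
      (Set.Ioi (-m)) ∧
    Tendsto (fun c => ∫ s in um..up, Real.sqrt (1 + (f s + c) ^ 2) / (f s + c))
      (𝓝[>] (-m)) atTop ∧
    Tendsto (fun c => ∫ s in um..up, Real.sqrt (1 + (f s + c) ^ 2) / (f s + c))
      atTop (𝓝 (up - um)) ∧
    ∀ r > up - um,
      ∃! c, c ∈ Set.Ioi (-m) ∧
        (∫ s in um..up, Real.sqrt (1 + (f s + c) ^ 2) / (f s + c)) = r := by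
  have hfc : Continuous f := hf.continuous
  have hle : ∀ s ∈ Icc um up, m ≤ f s := fun s hs => hm.2 (mem_image_of_mem f hs)
  have hpos : ∀ c ∈ Ioi (-m), ∀ s ∈ Icc um up, 0 < f s + c := fun c hc s hs => by
    have h1 : -m < c := hc
    linarith [hle s hs]
  have hcont : ∀ c ∈ Ioi (-m),
      ContinuousOn (fun s => Real.sqrt (1 + (f s + c) ^ 2) / (f s + c)) (Icc um up) :=
    fun c hc => ContinuousOn.div (by fun_prop) (by fun_prop) fun s hs => (hpos c hc s hs).ne'
  have hint : ∀ c ∈ Ioi (-m), IntervalIntegrable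
      (fun s => Real.sqrt (1 + (f s + c) ^ 2) / (f s + c)) volume um up :=
    fun c hc => (hcont c hc).intervalIntegrable_of_Icc hu.le
  have hanti : StrictAntiOn
      (fun c => ∫ s in um..up, Real.sqrt (1 + (f s + c) ^ 2) / (f s + c)) (Ioi (-m)) := by
    intro c hc d hd hcd
    have hlt : ∀ s ∈ Icc um up, Real.sqrt (1 + (f s + d) ^ 2) / (f s + d)
        < Real.sqrt (1 + (f s + c) ^ 2) / (f s + c) := fun s hs =>
      sqrt_one_add_sq_div_strictAntiOn (hpos c hc s hs) (hpos d hd s hs) (by linarith)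
    exact intervalIntegral.integral_lt_integral_of_continuousOn_of_le_of_exists_lt hu
      (hcont d hd) (hcont c hc) (fun s hs => (hlt s (Ioc_subset_Icc_self hs)).le)
      ⟨um, left_mem_Icc.2 hu.le, hlt um (left_mem_Icc.2 hu.le)⟩
  have htop : Tendsto (fun c => ∫ s in um..up, Real.sqrt (1 + (f s + c) ^ 2) / (f s + c))
      (𝓝[>] (-m)) atTop := by
    obtain ⟨⟨x, hx, hfx⟩, -⟩ := hm
    obtain ⟨C, hC⟩ := (isCompact_Icc (a := um) (b := up)).exists_bound_of_continuousOn
      (hf.continuous_deriv (by norm_num)).continuousOn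
    set K := max C 1
    have hK : 0 < K := lt_max_of_lt_right one_pos
    have hlip : ∀ s ∈ Icc um up, f s - m ≤ K * |s - x| := fun s hs => by
      have := (convex_Icc um up).norm_image_sub_le_of_norm_deriv_le (f := f) (C := K)
        (fun y _ => (hf.differentiable (by norm_num)).differentiableAt)
        (fun y hy => (hC y hy).trans (le_max_left _ _)) hx hs
      rw [hfx] at this
      exact (le_abs_self _).trans this
    have hlog : Tendsto (fun c => (Real.log (K * (up - um)) - Real.log (c + m)) / K)
        (𝓝[>] (-m)) atTop := by
      refine Tendsto.atTop_div_const hK (tendsto_atTop_add_const_left _ _ ?_)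
      refine tendsto_neg_atBot_atTop.comp (Real.tendsto_log_nhdsGT_zero.comp ?_)
      refine tendsto_nhdsWithin_iff.2 ⟨tendsto_nhdsWithin_of_tendsto_nhds ?_, ?_⟩
      · have : Tendsto (fun c => c + m) (𝓝 (-m)) (𝓝 (-m + m)) :=
          (continuous_id.add continuous_const).tendsto _
        simpa using this
      · filter_upwards [self_mem_nhdsWithin] with c hc
        exact neg_lt_iff_pos_add.1 (mem_Ioi.1 hc)
    refine tendsto_atTop_mono' _ ?_ hlog
    filter_upwards [self_mem_nhdsWithin] with c hc
    have hδ : 0 < c + m := neg_lt_iff_pos_add.1 (mem_Ioi.1 hc)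
    refine (log_le_integral_one_div_abs hK hδ hx hu).trans ?_
    refine intervalIntegral.integral_mono_on hu.le ?_ (hint c hc) fun s hs => ?_
    · exact (continuous_const.div (by fun_prop) fun s => by positivity).intervalIntegrable _ _
    · refine le_trans ?_ (inv_le_sqrt_one_add_sq_div (hpos c hc s hs))
      exact one_div_le_one_div_of_le (hpos c hc s hs) (by linarith [hlip s hs])
  have hlim : Tendsto (fun c => ∫ s in um..up, Real.sqrt (1 + (f s + c) ^ 2) / (f s + c))
      atTop (𝓝 (up - um)) := by
    have hub : Tendsto (fun c => (up - um) * (1 + 1 / (m + c))) atTop (𝓝 (up - um)) := by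
      have h : Tendsto (fun c : ℝ => 1 / (m + c)) atTop (𝓝 0) :=
        (tendsto_atTop_add_const_left _ m tendsto_id).const_div_atTop 1
      simpa using (h.const_add 1).const_mul (up - um)
    refine tendsto_of_tendsto_of_tendsto_of_le_of_le' tendsto_const_nhds hub ?_ ?_
    · filter_upwards [Ioi_mem_atTop (-m)] with c hc
      simpa using intervalIntegral.integral_mono_on hu.le
        (intervalIntegrable_const (c := (1 : ℝ))) (hint c hc)
        fun s hs => one_le_sqrt_one_add_sq_div (hpos c hc s hs)
    · filter_upwards [Ioi_mem_atTop (-m)] with c hc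
      have hδ : 0 < m + c := by
        have : -m < c := hc
        linarith
      have := intervalIntegral.integral_mono_on hu.le (hint c hc)
        (intervalIntegrable_const (c := 1 + 1 / (m + c)))
        fun s hs => (sqrt_one_add_sq_div_le (hpos c hc s hs)).trans
          (by gcongr; exact hle s hs)
      rwa [intervalIntegral.integral_const, smul_eq_mul] at this
  have hcontΦ : ContinuousOn
      (fun c => ∫ s in um..up, Real.sqrt (1 + (f s + c) ^ 2) / (f s + c)) (Ioi (-m)) := by
    intro c hc
    obtain ⟨d, hd, hdc⟩ := exists_between (mem_Ioi.1 hc)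
    refine ContinuousAt.continuousWithinAt ?_
    refine intervalIntegral.continuousAt_of_dominated_interval
      (bound := fun s => Real.sqrt (1 + (f s + d) ^ 2) / (f s + d)) ?_ ?_ (hint d hd) ?_
    · filter_upwards [Ioi_mem_nhds hc] with e he
      exact (intervalIntegrable_iff.1 (hint e he)).aestronglyMeasurable
    · filter_upwards [Ioi_mem_nhds hdc] with e he
      refine Eventually.of_forall fun s hs => ?_
      rw [uIoc_of_le hu.le] at hs
      have hs' := Ioc_subset_Icc_self hs
      have hde : d < e := he
      have hse := hpos e (hd.trans hde) s hs'
      rw [Real.norm_of_nonneg (by positivity)]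
      exact sqrt_one_add_sq_div_strictAntiOn.antitoneOn (hpos d hd s hs') hse (by linarith)
    · refine Eventually.of_forall fun s hs => ?_
      rw [uIoc_of_le hu.le] at hs
      exact ContinuousAt.div (by fun_prop) (by fun_prop)
        (hpos c hc s (Ioc_subset_Icc_self hs)).ne'
  refine ⟨hanti, htop, hlim, fun r hr => ?_⟩
  obtain ⟨a, har, ha⟩ := ((htop.eventually_ge_atTop r).and self_mem_nhdsWithin).exists
  obtain ⟨b, hbr, hab⟩ := ((hlim.eventually_lt_const hr).and (eventually_ge_atTop a)).exists
  obtain ⟨c, hc, hcr⟩ := intermediate_value_Icc' hab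
    (hcontΦ.mono fun y hy => lt_of_lt_of_le (mem_Ioi.1 ha) hy.1) ⟨hbr.le, har⟩
  have hcm : c ∈ Ioi (-m) := lt_of_lt_of_le (mem_Ioi.1 ha) hc.1
  exact ⟨c, ⟨hcm, hcr⟩, fun y hy => hanti.injOn hy.1 hcm (hy.2.trans hcr.symm)⟩
end

section
/- Let ε>0, ℓ>0, let f ∈ C²(ℝ) satisfy f(0)=f'(0)=0, f''(u) ≥ c_0 > 0 for all u, f(u_+)=f(u_-) < 1/2 with u_+ < 0 < u_-, and let ξ ∈ (−ℓ,ℓ). If κ_+ ∈ (f(u_±), 1/2) satisfies ∫_0^{u_+} [1+√(1−4(κ_+−f(s))²)]/[2(κ_+−f(s))] ds = (ξ−ℓ)/ε, then u_+ f'(u_+)/(exp(2f'(u_+)(ξ−ℓ)/ε) − 1) ≤ κ_+ − f(u_±) ≤ f(u_±)/(exp(f(u_±)(ξ−ℓ)/(ε u_+)) − 1). If κ_- ∈ (f(u_±), 1/2) satisfies ∫_0^{u_-} [1+√(1−4(κ_−−f(s))²)]/[2(κ_−−f(s))] ds = (ξ+ℓ)/ε, then u_- f'(u_-)/(exp(2f'(u_-)(ξ+ℓ)/ε)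 − 1) ≤ κ_- − f(u_±) ≤ f(u_±)/(exp(f(u_±)(ξ+ℓ)/(ε u_-)) − 1). -/
open Set Filter Topology MeasureTheory

theorem continuousOn_one_div_sub_mul {a b u : ℝ} (hb : 0 < b) (hab : 0 < a - b * u) :
    ContinuousOn (fun s : ℝ => 1 / (a - b * s)) (Icc 0 u) := by
  refine ContinuousOn.div (by fun_prop) (by fun_prop) fun s hs => ?_
  nlinarith [mul_le_mul_of_nonneg_left hs.2 hb.le]

theorem integral_one_div_sub_mul {a b u : ℝ} (hu : 0 ≤ u) (hb : 0 < b) (hab : 0 < a - b * u) :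
    ∫ s in (0 : ℝ)..u, 1 / (a - b * s) = (Real.log a - Real.log (a - b * u)) / b := by
  have key : ∀ s ∈ uIcc 0 u,
      HasDerivAt (fun s : ℝ => -(Real.log (a - b * s) / b)) (1 / (a - b * s)) s := by
    intro s hs
    rw [uIcc_of_le hu] at hs
    have hpos : a - b * s ≠ 0 := by nlinarith [mul_le_mul_of_nonneg_left hs.2 hb.le]
    have h : HasDerivAt (fun s : ℝ => a - b * s) (-(b * 1)) s :=
      ((hasDerivAt_id s).const_mul b).const_sub a
    refine ((h.log hpos).div_const b).neg.congr_deriv ?_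
    field_simp
  rw [intervalIntegral.integral_eq_sub_of_hasDerivAt key]
  · simp only [mul_zero, sub_zero]
    ring
  · apply ContinuousOn.intervalIntegrable
    rw [uIcc_of_le hu]
    exact continuousOn_one_div_sub_mul hb hab

/-- Bounds on the first integral `κ` when the flux `φ` lies between its chord and its tangent
line of slope `p` at `u`. -/
theorem first_integral_bounds {φ : ℝ → ℝ} {u F p κ D : ℝ} (hφ : Continuous φ)
    (hu : 0 < u) (hF : 0 < F) (hp : 0 < p) (hκ : F < κ) (hD : 0 < D)
    (hchord : ∀ s ∈ Icc 0 u, φ s ≤ F / u * s)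
    (htan : ∀ s ∈ Icc 0 u, F + p * (s - u) ≤ φ s)
    (hint : (∫ s in (0 : ℝ)..u,
      (1 + Real.sqrt (1 - 4 * (κ - φ s) ^ 2)) / (2 * (κ - φ s))) = D) :
    u * p / (Real.exp (2 * p * D) - 1) ≤ κ - F ∧
      κ - F ≤ F / (Real.exp (F / u * D) - 1) := by
  have hFu : 0 < F / u := div_pos hF hu
  have hFuu : F / u * u = F := div_mul_cancel₀ F hu.ne'
  have hlt : ∀ s ∈ Icc 0 u, 0 < κ - F / u * s := fun s hs => by
    nlinarith [mul_le_mul_of_nonneg_left hs.2 hFu.le]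
  have hpos : ∀ s ∈ Icc 0 u, 0 < κ - φ s := fun s hs => by
    linarith [hlt s hs, hchord s hs]
  have hI : IntervalIntegrable
      (fun s => (1 + Real.sqrt (1 - 4 * (κ - φ s) ^ 2)) / (2 * (κ - φ s))) volume 0 u := by
    apply ContinuousOn.intervalIntegrable
    rw [uIcc_of_le hu.le]
    refine ContinuousOn.div (by fun_prop) (by fun_prop) fun s hs => ?_
    have := hpos s hs
    positivity
  have hab₁ : 0 < κ - F / u * u := by linarith
  have hab₂ : 0 < (κ - F + p * u) - p * u := by linarith
  have hI₁ : IntervalIntegrable (fun s => 1 / (κ - F / u * s)) volume 0 u := by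
    apply ContinuousOn.intervalIntegrable
    rw [uIcc_of_le hu.le]
    exact continuousOn_one_div_sub_mul hFu hab₁
  have hI₂ : IntervalIntegrable (fun s => 1 / ((κ - F + p * u) - p * s)) volume 0 u := by
    apply ContinuousOn.intervalIntegrable
    rw [uIcc_of_le hu.le]
    exact continuousOn_one_div_sub_mul hp hab₂
  have hupper : D ≤ ∫ s in (0 : ℝ)..u, 1 / (κ - F / u * s) := by
    rw [← hint]
    refine intervalIntegral.integral_mono_on hu.le hI hI₁ fun s hs => ?_
    have h1 : Real.sqrt (1 - 4 * (κ - φ s) ^ 2) ≤ 1 :=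
      Real.sqrt_le_one.mpr (by nlinarith [sq_nonneg (κ - φ s)])
    have h2 := hpos s hs
    have h3 := hlt s hs
    have h4 := hchord s hs
    rw [div_le_div_iff₀ (by linarith) h3]
    nlinarith
  have hlower : (∫ s in (0 : ℝ)..u, 1 / ((κ - F + p * u) - p * s)) ≤ 2 * D := by
    rw [← hint, ← intervalIntegral.integral_const_mul]
    refine intervalIntegral.integral_mono_on hu.le hI₂ (hI.const_mul 2) fun s hs => ?_
    have h1 : 0 ≤ Real.sqrt (1 - 4 * (κ - φ s) ^ 2) := Real.sqrt_nonneg _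
    have h2 := hpos s hs
    have h4 := htan s hs
    have h3 : κ - φ s ≤ (κ - F + p * u) - p * s := by linarith
    calc 1 / ((κ - F + p * u) - p * s) ≤ 1 / (κ - φ s) := one_div_le_one_div_of_le h2 h3
      _ ≤ (1 + Real.sqrt (1 - 4 * (κ - φ s) ^ 2)) / (κ - φ s) := by gcongr; linarith
      _ = 2 * ((1 + Real.sqrt (1 - 4 * (κ - φ s) ^ 2)) / (2 * (κ - φ s))) := by
        field_simp
  rw [integral_one_div_sub_mul hu.le hFu hab₁, hFuu, le_div_iff₀ hFu,
    ← Real.log_div (by linarith) (by linarith), mul_comm,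
    Real.le_log_iff_exp_le (div_pos (by linarith) (by linarith)),
    le_div_iff₀ (by linarith)] at hupper
  rw [integral_one_div_sub_mul hu.le hp hab₂, add_sub_cancel_right, div_le_iff₀ hp,
    ← Real.log_div (by nlinarith) (by linarith),
    Real.log_le_iff_le_exp (div_pos (by nlinarith) (by linarith)),
    div_le_iff₀ (by linarith), show 2 * D * p = 2 * p * D by ring] at hlower
  have he₁ : 1 < Real.exp (F / u * D) := Real.one_lt_exp_iff.mpr (by positivity)
  have he₂ : 1 < Real.exp (2 * p * D) := Real.one_lt_exp_iff.mpr (by positivity)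
  constructor
  · rw [div_le_iff₀ (by linarith)]
    linarith
  · rw [le_div_iff₀ (by linarith)]
    linarith

theorem first_integral_bounds_of_convex {f : ℝ → ℝ} (hf : ContDiff ℝ 2 f) (hf0 : f 0 = 0)
    (hf'0 : deriv f 0 = 0) (hconv : ∀ u : ℝ, 0 < deriv (deriv f) u) {u κ D : ℝ}
    (hu : 0 < u) (hκ : f u < κ) (hD : 0 < D)
    (hint : (∫ s in (0 : ℝ)..u,
      (1 + Real.sqrt (1 - 4 * (κ - f s) ^ 2)) / (2 * (κ - f s))) = D) :
    u * deriv f u / (Real.exp (2 * deriv f u * D) - 1) ≤ κ - f u ∧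
      κ - f u ≤ f u / (Real.exp (f u / u * D) - 1) := by
  have hmono : StrictMono (deriv f) := strictMono_of_deriv_pos hconv
  have hd : Differentiable ℝ f := hf.differentiable (by norm_num)
  have hcvx : ConvexOn ℝ univ f := hmono.monotone.convexOn_univ_of_deriv hd
  have hp : 0 < deriv f u := hf'0 ▸ hmono hu
  have hF : 0 < f u := by
    have hs : StrictMonoOn f (Ici 0) := by
      refine strictMonoOn_of_deriv_pos (convex_Ici 0) hf.continuous.continuousOn fun x hx => ?_
      rw [interior_Ici] at hx
      exact hf'0 ▸ hmono hx
    exact hf0 ▸ hs self_mem_Ici hu.le hu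
  refine first_integral_bounds hf.continuous hu hF hp hκ hD (fun s hs => ?_) (fun s hs => ?_) hint
  · have h := hcvx.2 (mem_univ 0) (mem_univ u) (sub_nonneg.mpr ((div_le_one hu).mpr hs.2))
      (div_nonneg hs.1 hu.le) (by ring)
    simp only [smul_eq_mul, hf0, mul_zero, zero_add, div_mul_cancel₀ s hu.ne'] at h
    exact h.trans_eq (by ring)
  · rcases hs.2.eq_or_lt with rfl | hlt
    · simp
    · have h := hcvx.slope_le_deriv (mem_univ s) (mem_univ u) hlt (hd u)
      rw [slope_def_field, div_le_iff₀ (by linarith)] at h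
      linarith

theorem stmt_17
    (ε l : ℝ) (hε : 0 < ε) (hl : 0 < l)
    (c₀ : ℝ) (hc₀ : 0 < c₀)
    (f : ℝ → ℝ) (hf : ContDiff ℝ 2 f)
    (hf0 : f 0 = 0) (hf'0 : deriv f 0 = 0)
    (hconv : ∀ u : ℝ, c₀ ≤ deriv (deriv f) u)
    (up um : ℝ) (hup : up < 0) (hum : 0 < um)
    (hfeq : f up = f um) (hfsmall : f up < 1 / 2)
    (ξ : ℝ) (hξ : ξ ∈ Set.Ioo (-l) l) :
    (∀ κp : ℝ, f up < κp → κp < 1 / 2 →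
      (∫ s in (0 : ℝ)..up,
          (1 + Real.sqrt (1 - 4 * (κp - f s) ^ 2)) / (2 * (κp - f s))) = (ξ - l) / ε →
      up * deriv f up / (Real.exp (2 * deriv f up * (ξ - l) / ε) - 1) ≤ κp - f up ∧
      κp - f up ≤ f up / (Real.exp (f up * (ξ - l) / (ε * up)) - 1)) ∧
    (∀ κm : ℝ, f up < κm → κm < 1 / 2 →
      (∫ s in (0 : ℝ)..um,
          (1 + Real.sqrt (1 - 4 * (κm - f s) ^ 2)) / (2 * (κm - f s))) = (ξ + l) / ε →
      um * deriv f um / (Real.exp (2 * deriv f um * (ξ + l) / ε) - 1) ≤ κm - f up ∧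
      κm - f up ≤ f up / (Real.exp (f up * (ξ + l) / (ε * um)) - 1)) := by
  have hpos : ∀ u : ℝ, 0 < deriv (deriv f) u := fun u => hc₀.trans_le (hconv u)
  constructor
  · intro κ hκ _ hint
    have hderiv : deriv (fun s => f (-s)) = fun s => -deriv f (-s) :=
      funext fun s => deriv_comp_neg f s
    have hD : 0 < (l - ξ) / ε := div_pos (by linarith [hξ.2]) hε
    have key := first_integral_bounds_of_convex (f := fun s => f (-s)) (u := -up) (κ := κ)
      (D := (l - ξ) / ε) (hf.comp contDiff_neg) (by simpa using hf0)
      (by simp [hderiv, hf'0])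
      (fun u => by
        rw [hderiv, deriv.fun_neg, deriv_comp_neg (deriv f) u, neg_neg]
        exact hpos _)
      (by linarith) (by simpa using hκ) hD
      (by
        rw [intervalIntegral.integral_comp_neg
          (fun s => (1 + Real.sqrt (1 - 4 * (κ - f s) ^ 2)) / (2 * (κ - f s))),
          neg_neg, neg_zero, intervalIntegral.integral_symm, hint]
        ring)
    simp only [hderiv, neg_neg] at key
    rwa [neg_mul_neg, show 2 * -deriv f up * ((l - ξ) / ε) = 2 * deriv f up * (ξ - l) / ε by ring,
      show f up / -up * ((l - ξ) / ε) = f up * (ξ - l) / (ε * up) by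
        field_simp
        ring] at key
  · intro κ hκ _ hint
    have hD : 0 < (ξ + l) / ε := div_pos (by linarith [hξ.1]) hε
    rw [hfeq] at hκ ⊢
    convert first_integral_bounds_of_convex hf hf0 hf'0 hpos hum hκ hD hint using 4
    · congr 1
      ring
    · congr 1
      field_simp
end

section
/- Let ℓ>0, let p ∈ C¹([−ℓ,ℓ]) with p(x) > 0 for all x ∈ [−ℓ,ℓ], let f ∈ C²(ℝ) and U ∈ C²([−ℓ,ℓ]), and suppose λ ∈ ℝ and φ ∈ C²([−ℓ,ℓ]) satisfy the Dirichlet eigenvalue problem p(x)φ''(x) + (p'(x) − f'(U(x)))φ'(x) − f''(U(x))U'(x)φ(x) = λ φ(x) on [−ℓ,ℓ] with φ(±ℓ)=0, φ(x) > 0 for x ∈ (−ℓ,ℓ), φ'(−ℓ) > 0 and φ'(ℓ) < 0. Then λ < 0. -/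
open Set Filter Topology

theorem stmt_19
    (l lam : ℝ) (hl : 0 < l)
    (f : ℝ → ℝ) (hf : ContDiff ℝ 2 f)
    (p p' U U' U'' φ φ' φ'' : ℝ → ℝ)
    -- p is C¹ on [-l,l] and positive
    (hp : ∀ x ∈ Set.Icc (-l) l, HasDerivAt p (p' x) x)
    (hp' : ContinuousOn p' (Set.Icc (-l) l))
    (hppos : ∀ x ∈ Set.Icc (-l) l, 0 < p x)
    -- U is C² on [-l,l]
    (hU : ∀ x ∈ Set.Icc (-l) l, HasDerivAt U (U' x) x)
    (hU' : ∀ x ∈ Set.Icc (-l) l, HasDerivAt U' (U'' x) x)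
    (hU'' : ContinuousOn U'' (Set.Icc (-l) l))
    -- φ is C² on [-l,l]
    (hφ : ∀ x ∈ Set.Icc (-l) l, HasDerivAt φ (φ' x) x)
    (hφ' : ∀ x ∈ Set.Icc (-l) l, HasDerivAt φ' (φ'' x) x)
    (hφ'' : ContinuousOn φ'' (Set.Icc (-l) l))
    -- the eigenvalue equation
    (heq : ∀ x ∈ Set.Icc (-l) l,
      p x * φ'' x + (p' x - deriv f (U x)) * φ' x
        - deriv (deriv f) (U x) * U' x * φ x = lam * φ x)
    -- Dirichlet boundary conditions and positivity
    (hbcm : φ (-l) = 0) (hbcp : φ l = 0)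
    (hpos : ∀ x ∈ Set.Ioo (-l) l, 0 < φ x)
    (hdm : 0 < φ' (-l)) (hdp : φ' l < 0) :
    lam < 0 := by
  by_contra! hlam
  have hflux : ∀ x ∈ Set.Icc (-l) l,
      HasDerivAt (fun y => p y * φ' y - deriv f (U y) * φ y) (lam * φ x) x := by
    intro x hx
    have hdf : HasDerivAt (deriv f) (deriv (deriv f) (U x)) (U x) :=
      ((hf.iterate_deriv' 1 1).differentiable (by norm_num)).differentiableAt.hasDerivAt
    refine (((hp x hx).mul (hφ' x hx)).sub
      ((hdf.comp x (hU x hx)).mul (hφ x hx))).congr_deriv ?_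
    simp only [Function.comp_apply]
    linear_combination heq x hx
  have hmono : MonotoneOn (fun y => p y * φ' y - deriv f (U y) * φ y) (Set.Icc (-l) l) := by
    refine monotoneOn_of_hasDerivWithinAt_nonneg (f' := fun x => lam * φ x) (convex_Icc _ _)
      (fun x hx => (hflux x hx).continuousAt.continuousWithinAt)
      (fun x hx => (hflux x (interior_subset hx)).hasDerivWithinAt) fun x hx => ?_
    rw [interior_Icc] at hx
    exact mul_nonneg hlam (hpos x hx).le
  have hle : -l ≤ l := by linarith
  have hends := hmono (left_mem_Icc.2 hle) (right_mem_Icc.2 hle) hle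
  simp only [hbcm, hbcp, mul_zero, sub_zero] at hends
  have hleft := mul_pos (hppos _ (left_mem_Icc.2 hle)) hdm
  have hright := mul_neg_of_pos_of_neg (hppos _ (right_mem_Icc.2 hle)) hdp
  linarith
end
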